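/- There exist absolute constants c, K > 0 such that for all x ≥ y ≥ 2 with y ≥ (log x)^3 and u = log x / log y, the sum of 1/d over all positive integers d > x whose largest prime factor is at most y is at most K · (log y) / u^u. -/

import Mathlib

open Finset

lemma abel_cmp (a b f : ℕ → ℝ) (hf : ∀ n, f (n+1) ≤ f n) (hf0 : ∀ n, 0 ≤ f n)
    (h : ∀ n, ∑ i ∈ range n, a i ≤ ∑ i ∈ range n, b i) (N : ℕ) :
    ∑ i ∈ range N, a i * f i ≤ ∑ i ∈ range N, b i * f i := by
  have key : ∀ N, f N * ∑ i ∈ range (N+1), (b i - a i) ≤ ∑ i ∈ range (N+1), (b i - a i) * f i := by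
    intro N
    induction N with
    | zero => simp [mul_comm]
    | succ k ih =>
      rw [sum_range_succ _ (k+1), sum_range_succ _ (k+1)]
      have h1 : 0 ≤ ∑ i ∈ range (k+1), (b i - a i) := by
        rw [sum_sub_distrib]; linarith [h (k+1)]
      nlinarith [mul_le_mul_of_nonneg_right (hf k) h1]
  cases N with
  | zero => simp
  | succ k =>
    have h1 : 0 ≤ ∑ i ∈ range (k+1), (b i - a i) := by
      rw [sum_sub_distrib]; linarith [h (k+1)]
    have h2 := (mul_nonneg (hf0 k) h1).trans (key k)
    simp only [sub_mul, sum_sub_distrib] at h2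
    linarith

lemma sum_primesBelow_shift (g : ℕ → ℝ) (M : ℕ) :
    ∑ p ∈ (M+2).primesBelow, g p = ∑ i ∈ range M, if (i+2).Prime then g (i+2) else 0 := by
  rw [Nat.primesBelow, sum_filter, sum_range_succ', sum_range_succ']
  simp [Nat.not_prime_zero, Nat.not_prime_one]

lemma theta_bound (n : ℕ) : ∑ p ∈ (n+1).primesBelow, Real.log p ≤ Real.log 4 * n := by
  have := Chebyshev.theta_le_log4_mul_x (x := (n:ℝ)) (by positivity)
  rw [Chebyshev.theta_eq_sum_primesLE_log] at this
  rw [Nat.primesBelow]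
  rw [Nat.primesLE_eq_filter_Icc_zero] at this
  convert this using 2
  ext p; simp

lemma sum_log_dvd (m : ℕ) (hm : m ≠ 0) : ∑ p ∈ m.primeFactors, Real.log p ≤ Real.log m := by
  rw [← Real.log_prod (fun p hp => by
    have := (Nat.prime_of_mem_primeFactors hp).pos
    positivity)]
  have h1 := Nat.le_of_dvd (Nat.pos_of_ne_zero hm) (Nat.prod_primeFactors_dvd m)
  have h2 : 0 < ∏ p ∈ m.primeFactors, p := prod_pos fun p hp => (Nat.prime_of_mem_primeFactors hp).pos
  apply Real.log_le_log
  · rw [← Nat.cast_prod]; exact_mod_cast h2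
  · rw [← Nat.cast_prod]; exact_mod_cast h1

lemma mertens1 (n : ℕ) (hn : 0 < n) :
    ∑ p ∈ (n+1).primesBelow, Real.log p / p ≤ Real.log n + Real.log 4 := by
  have h1 : ∑ p ∈ (n+1).primesBelow, ((n / p : ℕ):ℝ) * Real.log p ≤ n * Real.log n := by
    calc ∑ p ∈ (n+1).primesBelow, ((n / p : ℕ):ℝ) * Real.log p
        = ∑ p ∈ (n+1).primesBelow, ∑ k ∈ range (n+1), if k ≠ 0 ∧ p ∣ k then Real.log p else 0 := by
          apply sum_congr rfl
          intro p hp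
          rw [← Nat.card_multiples' n p, ← sum_filter]
          simp
      _ = ∑ k ∈ range (n+1), ∑ p ∈ (n+1).primesBelow, if k ≠ 0 ∧ p ∣ k then Real.log p else 0 := sum_comm
      _ ≤ ∑ k ∈ range (n+1), if k = 0 then 0 else Real.log n := by
          apply sum_le_sum
          intro k hk
          by_cases hk0 : k = 0
          · simp [hk0]
          · simp only [ne_eq, hk0, not_false_eq_true, true_and, if_false]
            rw [← sum_filter]
            have hkn : k ≤ n := by simpa [Nat.lt_succ_iff] using hk
            refine le_trans (sum_le_sum_of_subset_of_nonneg (t := k.primeFactors) ?_ ?_) ((sum_log_dvd k hk0).trans ?_)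
            · intro p hp
              simp only [mem_filter, Nat.mem_primesBelow] at hp
              exact Nat.mem_primeFactors.2 ⟨hp.1.2, hp.2, hk0⟩
            · intro p _ _
              exact Real.log_natCast_nonneg p
            · apply Real.log_le_log
              · exact_mod_cast Nat.pos_of_ne_zero hk0
              · exact_mod_cast hkn
      _ = n * Real.log n := by
          rw [sum_range_succ']
          simp
  have h2 := theta_bound n
  have hn' : (0:ℝ) < n := by exact_mod_cast hn
  have h3 : n * ∑ p ∈ (n+1).primesBelow, Real.log p / p ≤
      ∑ p ∈ (n+1).primesBelow, ((n / p : ℕ):ℝ) * Real.log p + ∑ p ∈ (n+1).primesBelow, Real.log p := by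
    rw [mul_sum, ← sum_add_distrib]
    apply sum_le_sum
    intro p hp
    have := Nat.lt_floor_add_one ((n:ℝ)/p)
    rw [Nat.floor_div_eq_div] at this
    have hl := Real.log_natCast_nonneg p
    calc (n:ℝ) * (Real.log p / p) = (n/p) * Real.log p := by ring
      _ ≤ (((n / p : ℕ):ℝ) + 1) * Real.log p := by gcongr
      _ = _ := by ring
  have : n * ∑ p ∈ (n+1).primesBelow, Real.log p / p ≤ n * (Real.log n + Real.log 4) := by linarith
  exact le_of_mul_le_mul_left this hn'

lemma mertens2 : ∃ C : ℝ, ∀ M : ℕ, 1 ≤ M →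
    ∑ p ∈ (M+2).primesBelow, (1:ℝ) / p ≤ Real.log (Real.log (M+1)) + C := by
  set b : ℕ → ℝ := fun i => (Real.log (i+2) - Real.log (i+1)) + if i = 0 then Real.log 4 else 0 with hb
  have hlog : ∀ i : ℕ, 0 < Real.log ((i:ℝ)+2) := fun i => Real.log_pos (by
    have : (0:ℝ) ≤ i := by positivity
    linarith)
  have hbs : ∀ M, ∑ i ∈ range (M+1), b i = Real.log (M+2) + Real.log 4 := by
    intro M
    induction M with
    | zero => simp [hb]
    | succ k ih => rw [sum_range_succ, ih]; simp only [hb]; push_cast; simp; ring_nf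
  have hcmp : ∀ M : ℕ, ∑ p ∈ (M+2).primesBelow, (1:ℝ) / p ≤ ∑ i ∈ range M, b i * (1 / Real.log (i+2)) := by
    intro M
    rw [sum_primesBelow_shift (fun p => (1:ℝ)/p)]
    refine le_trans (le_of_eq ?_) (abel_cmp (fun i => if (i+2).Prime then Real.log (i+2) / (i+2) else 0) b (fun i => 1 / Real.log (i+2)) ?_ ?_ ?_ M)
    · apply sum_congr rfl
      intro i _
      have := hlog i
      split_ifs
      · push_cast; field_simp
      · simp
    · intro n
      have := hlog n
      push_cast
      gcongr
      linarith
    · intro n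
      have := hlog n
      positivity
    · intro n
      have h1 := sum_primesBelow_shift (fun p => Real.log p/p) n
      push_cast at h1
      rw [← h1]
      cases n with
      | zero => simp [Nat.primesBelow, sum_filter, sum_range_succ, Nat.not_prime_zero, Nat.not_prime_one]
      | succ k =>
        rw [hbs k]
        have := mertens1 (k+2) (by omega)
        push_cast at this
        exact this
  have hb2 : ∀ k : ℕ, ∑ i ∈ range (k+1), b i * (1 / Real.log (i+2)) ≤ Real.log (Real.log (k+2)) + (b 0 * (1 / Real.log 2) - Real.log (Real.log 2)) := by
    intro k
    induction k with
    | zero => simp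
    | succ k ih =>
      rw [sum_range_succ]
      have h1 := hlog k
      have h2 := hlog (k+1)
      push_cast at h2 ⊢
      have : b (k+1) * (1 / Real.log (k+1+2)) ≤ Real.log (Real.log (k+1+2)) - Real.log (Real.log (k+2)) := by
        have h3 := Real.one_sub_inv_le_log_of_pos (x := Real.log (k+1+2) / Real.log (k+2)) (by positivity)
        rw [Real.log_div (by positivity) (by positivity)] at h3
        refine le_trans (le_of_eq ?_) h3
        simp only [hb]
        push_cast
        simp
        rw [show (k:ℝ)+1+1 = k+2 by ring]
        field_simp
      linarith
  refine ⟨b 0 * (1 / Real.log 2) - Real.log (Real.log 2), fun M hM => ?_⟩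
  obtain ⟨k, rfl⟩ : ∃ k, M = k+1 := ⟨M-1, by omega⟩
  have := (hcmp (k+1)).trans (hb2 k)
  push_cast
  rw [show (k:ℝ)+1+1 = k+2 by ring]
  exact this

lemma sum_rpow_bound (ε : ℝ) (h0 : 0 < ε) (h1 : ε ≤ 1) (M : ℕ) :
    ∑ i ∈ range M, ((i:ℝ)+2) ^ (ε-1) ≤ ((M:ℝ)+1)^ε / ε := by
  induction M with
  | zero => simp; positivity
  | succ k ih =>
    rw [sum_range_succ]
    have hk : (0:ℝ) ≤ k := by positivity
    have h := rpow_one_add_le_one_add_mul_self (s := -1/((k:ℝ)+2)) (by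
      rw [le_div_iff₀ (by positivity)]; linarith) h0.le h1
    have e1 : (1 + -1/((k:ℝ)+2)) = (k+1)/(k+2) := by field_simp; ring
    rw [e1, Real.div_rpow (by positivity) (by positivity), div_le_iff₀ (by positivity)] at h
    have e2 : ((k:ℝ)+2)^(ε-1) = (k+2)^ε / (k+2) := by
      rw [Real.rpow_sub_one (by positivity)]
    have : ((k:ℝ)+2)^(ε-1) ≤ ((k+2)^ε - (k+1)^ε)/ε := by
      rw [le_div_iff₀ h0, e2]
      have : (1 + ε * (-1 / ((k:ℝ) + 2))) * (k + 2) ^ ε = (k+2)^ε - (k+2)^ε/(k+2) * ε := by field_simp; ring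
      linarith
    push_cast
    rw [show (k:ℝ)+1+1 = k+2 by ring]
    have e3 : ((k:ℝ)+2)^ε/ε = (k+1)^ε/ε + ((k+2)^ε - (k+1)^ε)/ε := by ring
    linarith

lemma sum_log_rpow (ε : ℝ) (h0 : 0 < ε) (h1 : ε ≤ 1) (M : ℕ) :
    ∑ p ∈ (M+2).primesBelow, Real.log p * (p:ℝ) ^ (ε-1) ≤ 2 * Real.log 4 * (((M:ℝ)+1)^ε / ε) := by
  rw [sum_primesBelow_shift (fun p => Real.log p * (p:ℝ) ^ (ε-1))]
  calc _ = ∑ i ∈ range M, (if (i+2).Prime then Real.log (i+2) else 0) * ((i:ℝ)+2)^(ε-1) := by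
        apply sum_congr rfl; intro i _; split_ifs <;> simp
    _ ≤ ∑ i ∈ range M, (2 * Real.log 4) * ((i:ℝ)+2)^(ε-1) := by
        apply abel_cmp
        · intro n
          apply Real.rpow_le_rpow_of_nonpos (by positivity) (by push_cast; linarith) (by linarith)
        · intro n; positivity
        · intro n
          have h := sum_primesBelow_shift (fun p => Real.log p) n
          push_cast at h
          rw [← h]
          cases n with
          | zero => simp [Nat.primesBelow, sum_filter, sum_range_succ, Nat.not_prime_zero, Nat.not_prime_one]
          | succ k =>
            have h2 := theta_bound (k+2)
            simp only [sum_const, card_range, nsmul_eq_mul]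
            push_cast at h2 ⊢
            have : 0 ≤ Real.log 4 := Real.log_nonneg (by norm_num)
            have hk : (0:ℝ) ≤ k := by positivity
            refine h2.trans ?_
            nlinarith [mul_nonneg this hk]
    _ ≤ _ := by
        rw [← mul_sum]
        have : 0 ≤ Real.log 4 := Real.log_nonneg (by norm_num)
        gcongr
        exact sum_rpow_bound ε h0 h1 M

lemma euler_bound : ∃ K : ℝ, 0 < K ∧ ∀ ε : ℝ, ε ≤ 1/3 → ∀ N : ℕ, ∀ S : Finset ℕ,
    (∀ d ∈ S, d ∈ N.smoothNumbers) →
    ∑ d ∈ S, (d:ℝ)^(ε-1) ≤ K * Real.exp (∑ p ∈ N.primesBelow, (p:ℝ)^(ε-1)) := by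
  set c : ℝ := (2:ℝ)^(-(2/3):ℝ) with hc
  have hc1 : c < 1 := Real.rpow_lt_one_of_one_lt_of_neg (by norm_num) (by norm_num)
  have hsum : Summable (fun n : ℕ => (n:ℝ)^(-(4/3):ℝ)) := Real.summable_nat_rpow.2 (by norm_num)
  set T := ∑' n : ℕ, (n:ℝ)^(-(4/3):ℝ) with hT
  refine ⟨Real.exp (T / (1-c)), Real.exp_pos _, ?_⟩
  intro ε hε N S hS
  let f : ℕ →* ℝ :=
    { toFun := fun n => (n:ℝ)^(ε-1)
      map_one' := by simp
      map_mul' := fun m n => by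
        push_cast
        exact Real.mul_rpow (by positivity) (by positivity) }
  have hf : ∀ n : ℕ, f n = (n:ℝ)^(ε-1) := fun n => rfl
  have hf0 : ∀ n : ℕ, 0 ≤ f n := fun n => by rw [hf]; positivity
  have hq : ∀ p : ℕ, p.Prime → f p ≤ c := by
    intro p hp
    have h2 : (2:ℝ) ≤ p := by exact_mod_cast hp.two_le
    rw [hf]
    calc (p:ℝ)^(ε-1) ≤ (p:ℝ)^(-(2/3):ℝ) := Real.rpow_le_rpow_of_exponent_le (by linarith) (by linarith)
      _ ≤ c := Real.rpow_le_rpow_of_nonpos (by norm_num) h2 (by norm_num)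
  have hE := (EulerProduct.summable_and_hasSum_smoothNumbers_prod_primesBelow_geometric (f := f)
    (fun {p} hp => by
      rw [Real.norm_of_nonneg (hf0 p)]
      exact (hq p hp).trans_lt hc1) N).2
  have h1 : ∑ d ∈ S, (d:ℝ)^(ε-1) ≤ ∏ p ∈ N.primesBelow, (1 - f p)⁻¹ := by
    have := sum_le_hasSum (S.subtype (· ∈ N.smoothNumbers)) (fun i _ => hf0 i) hE
    rw [sum_subtype_of_mem (fun d => f d) hS] at this
    exact this
  refine h1.trans ?_
  rw [← Real.exp_add]
  have h2 : ∏ p ∈ N.primesBelow, (1 - f p)⁻¹ ≤ ∏ p ∈ N.primesBelow,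
      Real.exp ((p:ℝ)^(-(4/3):ℝ) / (1-c) + (p:ℝ)^(ε-1)) := by
    apply prod_le_prod
    · intro p hp
      have := hq p (Nat.prime_of_mem_primesBelow hp)
      exact inv_nonneg.2 (by linarith)
    · intro p hp
      have hp' := Nat.prime_of_mem_primesBelow hp
      have h3 := hq p hp'
      have h4 : 0 < 1 - f p := by linarith
      have h5 : (1 - f p)⁻¹ = (f p^2/(1 - f p) + f p) + 1 := by field_simp; ring
      have h6 : f p^2 ≤ (p:ℝ)^(-(4/3):ℝ) := by
        have h2 : (2:ℝ) ≤ p := by exact_mod_cast hp'.two_le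
        rw [hf, ← Real.rpow_natCast, ← Real.rpow_mul (by positivity)]
        apply Real.rpow_le_rpow_of_exponent_le (by linarith)
        push_cast; linarith
      rw [h5]
      refine (Real.add_one_le_exp _).trans (Real.exp_le_exp.2 ?_)
      rw [hf]
      rw [hf] at h6 h3 h4
      gcongr
  refine h2.trans ?_
  rw [← Real.exp_sum]
  apply Real.exp_le_exp.2
  rw [sum_add_distrib, ← sum_div]
  have : ∑ p ∈ N.primesBelow, (p:ℝ)^(-(4/3):ℝ) ≤ T := hsum.sum_le_tsum _ (fun i _ => by positivity)
  have : 0 < 1 - c := by linarith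
  gcongr

lemma prime_sum_eps (ε Y : ℝ) (hY : 2 ≤ Y) (h0 : 0 < ε) (h1 : ε ≤ 1) (M : ℕ) (hM : (M:ℝ)+1 ≤ Y) :
    ∑ p ∈ (M+2).primesBelow, (p:ℝ)^(ε-1) ≤ ∑ p ∈ (M+2).primesBelow, (1:ℝ)/p
      + 56 * (Real.exp (ε * Real.log Y) / (ε * Real.log Y)) := by
  set L := ε * Real.log Y with hL
  have hlY : Real.log 2 ≤ Real.log Y := Real.log_le_log (by norm_num) hY
  have hl2 : 0 < Real.log 2 := Real.log_pos (by norm_num)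
  have hl2' : Real.log 2 ≤ 1 := by linarith [Real.log_two_lt_d9]
  have hl4 : Real.log 4 = 2 * Real.log 2 := by
    rw [show (4:ℝ) = 2^2 by norm_num, Real.log_pow]; norm_num
  have hlYp : 0 < Real.log Y := by linarith
  have hLp : 0 < L := by positivity
  have hterm : ∀ p ∈ (M+2).primesBelow, (p:ℝ)^(ε-1) ≤ 1/p + (ε * Real.exp (L/2)) * (Real.log p/p)
      + (2/Real.log Y) * (Real.log p * (p:ℝ)^(ε-1)) := by
    intro p hp
    have hp' := Nat.prime_of_mem_primesBelow hp
    have hp0 : (0:ℝ) < p := by exact_mod_cast hp'.pos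
    have hlp : 0 ≤ Real.log p := Real.log_natCast_nonneg p
    by_cases hc : 2 * Real.log p ≤ Real.log Y
    · have e1 : (p:ℝ)^(ε-1) = Real.exp (Real.log p * ε) / p := by
        rw [Real.rpow_sub_one hp0.ne', Real.rpow_def_of_pos hp0]
      have e2 : Real.exp (Real.log p * ε) ≤ 1 + ε * Real.exp (L/2) * Real.log p := by
        have h3 := Real.add_one_le_exp (-(Real.log p * ε))
        have h4 : Real.exp (-(Real.log p * ε)) * Real.exp (Real.log p * ε) = 1 := by
          rw [← Real.exp_add]; simp
        have h5 : Real.exp (Real.log p * ε) ≤ Real.exp (L/2) := by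
          apply Real.exp_le_exp.2
          rw [hL]; nlinarith
        have h6 := mul_le_mul_of_nonneg_right h3 (Real.exp_pos (Real.log p * ε)).le
        have h7 := mul_le_mul_of_nonneg_left h5 (mul_nonneg hlp h0.le)
        nlinarith
      have e3 : 0 ≤ (2/Real.log Y) * (Real.log p * (p:ℝ)^(ε-1)) := by positivity
      have e4 : (p:ℝ)^(ε-1) ≤ 1/p + (ε * Real.exp (L/2)) * (Real.log p/p) := by
        rw [e1]
        calc _ ≤ (1 + ε * Real.exp (L/2) * Real.log p)/p := by gcongr
          _ = _ := by ring
      linarith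
    · push Not at hc
      have e3 : 0 ≤ 1/p + (ε * Real.exp (L/2)) * (Real.log p/p) := by positivity
      have e4 : (p:ℝ)^(ε-1) ≤ (2/Real.log Y) * (Real.log p * (p:ℝ)^(ε-1)) := by
        have : 1 ≤ 2/Real.log Y * Real.log p := by
          rw [div_mul_eq_mul_div, le_div_iff₀ hlYp]; linarith
        have h8 : (0:ℝ) ≤ (p:ℝ)^(ε-1) := by positivity
        nlinarith
      linarith
  refine (sum_le_sum hterm).trans ?_
  rw [sum_add_distrib, sum_add_distrib, ← mul_sum, ← mul_sum, add_assoc]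
  gcongr
  have hm1 : ∑ p ∈ (M+2).primesBelow, Real.log p / p ≤ 3 * Real.log Y := by
    have h := mertens1 (M+1) (by omega)
    push_cast at h
    have h' : Real.log ((M:ℝ)+1) ≤ Real.log Y := Real.log_le_log (by positivity) hM
    have : ∑ p ∈ (M+2).primesBelow, Real.log p / p ≤ Real.log ((M:ℝ)+1) + Real.log 4 := h
    linarith
  have hm2 : ∑ p ∈ (M+2).primesBelow, Real.log p * (p:ℝ) ^ (ε-1) ≤ 4 * (Real.exp L / ε) := by
    refine (sum_log_rpow ε h0 h1 M).trans ?_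
    have e : ((M:ℝ)+1)^ε ≤ Real.exp L := by
      rw [hL, mul_comm, ← Real.rpow_def_of_pos (by linarith)]
      exact Real.rpow_le_rpow (by positivity) hM h0.le
    have : 2 * Real.log 4 ≤ 4 := by linarith
    gcongr
  have hq : L * Real.exp (L/2) ≤ 16 * (Real.exp L / L) := by
    have h3 := Real.add_one_le_exp (L/4)
    have h4 : Real.exp (L/4) * Real.exp (L/4) = Real.exp (L/2) := by rw [← Real.exp_add]; ring_nf
    have h5 : Real.exp (L/2) * Real.exp (L/2) = Real.exp L := by rw [← Real.exp_add]; ring_nf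
    have h6 : L^2 ≤ 16 * Real.exp (L/2) := by nlinarith
    rw [← mul_div_assoc, le_div_iff₀ hLp]
    nlinarith [Real.exp_pos (L/2)]
  calc _ ≤ ε * Real.exp (L/2) * (3 * Real.log Y) + 2/Real.log Y * (4 * (Real.exp L / ε)) := by gcongr
    _ = 3 * (L * Real.exp (L/2)) + 8 * (Real.exp L / L) := by rw [hL]; field_simp; ring
    _ ≤ _ := by linarith

theorem stmt9 :
    ∃ K : ℝ, 0 < K ∧ ∀ x y : ℝ, 2 ≤ y → y ≤ x → (Real.log x) ^ 3 ≤ y →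
      ∀ S : Finset ℕ,
        (∀ d ∈ S, x < d ∧ ∀ p : ℕ, p.Prime → p ∣ d → (p : ℝ) ≤ y) →
        ∑ d ∈ S, (1 : ℝ) / d ≤
          K * Real.log y /
            (Real.log x / Real.log y) ^ (Real.log x / Real.log y) := by
  obtain ⟨C, hC⟩ := mertens2
  obtain ⟨K₁, hK₁, hE⟩ := euler_bound
  set U : ℝ := Real.exp (Real.exp 56) with hU
  have hU4 : 4 ≤ U := by
    have := Real.add_one_le_exp (56:ℝ)
    have := Real.add_one_le_exp (Real.exp 56)
    linarith
  have hUU : 1 ≤ U ^ U := Real.one_le_rpow (by linarith) (by linarith)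
  refine ⟨K₁ * Real.exp C * U ^ U, by positivity, ?_⟩
  intro x y hy hyx hxy S hS
  have hl2 : 0.69 < Real.log 2 := by linarith [Real.log_two_gt_d9]
  have hlY : Real.log 2 ≤ Real.log y := Real.log_le_log (by norm_num) hy
  have hly : 0 < Real.log y := by linarith
  have hlxy : Real.log y ≤ Real.log x := Real.log_le_log (by linarith) hyx
  set u := Real.log x / Real.log y with hu
  have hux : Real.log x = u * Real.log y := by rw [hu]; field_simp
  have hu1 : 1 ≤ u := by rw [hu, le_div_iff₀ hly]; linarith
  obtain ⟨M, hM1, hMf⟩ : ∃ M, 1 ≤ M ∧ ⌊y⌋₊ = M + 1 := by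
    have : 2 ≤ ⌊y⌋₊ := Nat.le_floor (by exact_mod_cast hy)
    exact ⟨⌊y⌋₊ - 1, by omega, by omega⟩
  have hMy : (M:ℝ) + 1 ≤ y := by
    have := Nat.floor_le (a := y) (by linarith)
    rw [hMf] at this; exact_mod_cast this
  have hd0 : ∀ d ∈ S, (0:ℝ) < d := fun d hd => by linarith [(hS d hd).1]
  have hSs : ∀ d ∈ S, d ∈ (M+2).smoothNumbers := by
    intro d hd
    have h0 : d ≠ 0 := by
      have := hd0 d hd
      exact_mod_cast this.ne'
    rw [Nat.mem_smoothNumbers']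
    intro p hp hpd
    have := Nat.le_floor ((hS d hd).2 p hp hpd)
    omega
  have hloglog : Real.log (Real.log ((M:ℝ)+1)) ≤ Real.log (Real.log y) := by
    have : (1:ℝ) ≤ M := by exact_mod_cast hM1
    apply Real.log_le_log (Real.log_pos (by linarith))
    exact Real.log_le_log (by positivity) hMy
  have hmert := (hC M hM1).trans (add_le_add_left hloglog C)
  have hupos : 0 < u ^ u := by positivity
  rw [le_div_iff₀ hupos]
  by_cases hcase : u ≤ U
  · have h1 := hE 0 (by norm_num) (M+2) S hSs
    simp only [zero_sub, Real.rpow_neg_one] at h1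
    simp only [one_div] at hmert ⊢
    have h2 : ∑ d ∈ S, ((d:ℝ))⁻¹ ≤ K₁ * Real.exp C * Real.log y := by
      refine h1.trans ?_
      calc _ ≤ K₁ * Real.exp (Real.log (Real.log y) + C) := by gcongr
        _ = _ := by rw [Real.exp_add, Real.exp_log hly]; ring
    have h3 : u ^ u ≤ U ^ U := by
      calc u ^ u ≤ U ^ u := Real.rpow_le_rpow (by linarith) hcase (by linarith)
        _ ≤ U ^ U := Real.rpow_le_rpow_of_exponent_le (by linarith) hcase
    calc _ ≤ (K₁ * Real.exp C * Real.log y) * U ^ U := by gcongr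
      _ = _ := by ring
  · push Not at hcase
    have hu4 : 4 ≤ u := by linarith
    have hu0 : 0 < u := by linarith
    have hlu : Real.exp 56 ≤ Real.log u := by
      rw [Real.le_log_iff_exp_le hu0]; exact hcase.le
    have hlu0 : 0 < Real.log u := (Real.exp_pos _).trans_le hlu
    have hllu : 56 ≤ Real.log (Real.log u) := by
      rw [Real.le_log_iff_exp_le hlu0]; exact hlu
    set L := Real.log u + Real.log (Real.log u) with hL
    have hLp : 0 < L := by linarith
    have hexpL : Real.exp L = u * Real.log u := by
      rw [hL, Real.exp_add, Real.exp_log hu0, Real.exp_log hlu0]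
    set ε := L / Real.log y with hε
    have hεL : ε * Real.log y = L := by rw [hε]; field_simp
    have hε0 : 0 < ε := by positivity
    have huy : u ≤ y := by
      rw [hux, mul_pow] at hxy
      have a1 : (0.3:ℝ) ≤ Real.log y ^ 3 := by
        have : (0.69:ℝ)^3 ≤ Real.log y ^ 3 := by gcongr; linarith
        norm_num at this ⊢; linarith
      have a2 : 4 * u ≤ u^3 := by nlinarith [mul_nonneg hu0.le (by nlinarith : 0 ≤ u^2 - 4)]
      have a3 : u^3 * 0.3 ≤ u^3 * Real.log y ^ 3 := by gcongr
      linarith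
    have hε3 : ε ≤ 1/3 := by
      have b1 : Real.log u ≤ Real.log y := Real.log_le_log hu0 huy
      have b2 : Real.exp L ≤ Real.log x := by rw [hexpL, hux]; gcongr
      have b3 : Real.exp (3 * L) ≤ y := by
        have : Real.exp (3 * L) = Real.exp L ^ 3 := by rw [← Real.exp_nat_mul]; norm_num
        rw [this]
        refine le_trans ?_ hxy
        gcongr
      have b4 : 3 * L ≤ Real.log y := by rwa [Real.le_log_iff_exp_le (by linarith)]
      rw [hε, div_le_iff₀ hly]; linarith
    have h1 := hE ε hε3 (M+2) S hSs
    have h2 := prime_sum_eps ε y hy hε0 (by linarith) M hMy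
    rw [hεL] at h2
    have h3 : Real.exp L / L ≤ u := by
      rw [div_le_iff₀ hLp, hexpL]
      gcongr
      linarith
    have h4 : ∑ p ∈ (M+2).primesBelow, (p:ℝ)^(ε-1) ≤ Real.log (Real.log y) + C + 56 * u := by linarith
    have h5 : ∑ d ∈ S, (1:ℝ)/d ≤ Real.exp (-(u * L)) * ∑ d ∈ S, (d:ℝ)^(ε-1) := by
      rw [mul_sum]
      apply sum_le_sum
      intro d hd
      have c0 := hd0 d hd
      have c1 : Real.log x ≤ Real.log d := Real.log_le_log (by linarith) (hS d hd).1.le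
      rw [Real.rpow_sub_one c0.ne', Real.rpow_def_of_pos c0, ← mul_div_assoc, ← Real.exp_add]
      gcongr
      apply Real.one_le_exp
      have : u * L = Real.log x * ε := by rw [hux, ← hεL]; ring
      rw [this]
      nlinarith
    have h6 : u ^ u = Real.exp (u * Real.log u) := by
      rw [Real.rpow_def_of_pos hu0, mul_comm]
    calc (∑ d ∈ S, (1:ℝ)/d) * u ^ u
        ≤ (Real.exp (-(u * L)) * (K₁ * Real.exp (Real.log (Real.log y) + C + 56 * u))) * u ^ u := by
          gcongr
          refine h5.trans ?_
          gcongr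
          refine h1.trans ?_
          gcongr
      _ = K₁ * Real.exp C * Real.log y * Real.exp (-(u * L) + 56 * u + u * Real.log u) := by
          simp only [h6, Real.exp_add, Real.exp_log hly]
          ring
      _ ≤ K₁ * Real.exp C * Real.log y * 1 := by
          gcongr
          apply Real.exp_le_one_iff.2
          rw [hL]
          nlinarith
      _ ≤ K₁ * Real.exp C * Real.log y * U ^ U := by gcongr
      _ = _ := by ring
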